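/- The [1/2] Padé approximant in Borel space has no pole on the Laplace integration path: if λ ∈ ℂ has negative real part, then 48 − 10λξ + (λξ)² ≠ 0 for every real ξ ≥ 0; hence the rational function P(ξ) = λ(48 + 14λξ)/(48 − 10λξ + (λξ)²) is defined on the whole positive real axis. -/

import Mathlib

/-- The [1/2] Padé approximant in Borel space has no pole on the Laplace
integration path: if `Re λ < 0` then `48 − 10λξ + (λξ)² ≠ 0` for every real
`ξ ≥ 0`. -/
theorem pade_denominator_no_pole_on_positive_axis
    (lam : ℂ) (hlam : lam.re < 0) :
    ∀ ξ : ℝ, 0 ≤ ξ → 48 - 10 * (lam * (ξ : ℂ)) + (lam * (ξ : ℂ)) ^ 2 ≠ 0 := by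
  intro ξ hξ h
  have hre : (lam * (ξ : ℂ)).re ≤ 0 := by
    simpa using mul_nonpos_of_nonpos_of_nonneg hlam.le hξ
  generalize lam * (ξ : ℂ) = z at h hre
  have h_real := congrArg Complex.re h
  have h_imag := congrArg Complex.im h
  simp [pow_two] at h_real h_imag
  have him : z.im = 0 := by
    have hprod : z.im * (z.re - 5) = 0 := by linarith
    exact (mul_eq_zero.mp hprod).resolve_right (by linarith)
  rw [him] at h_real
  nlinarith [sq_nonneg z.re]
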